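/- arXiv:2504.19756 — 2 statements merged into one kernel-verified Lean document; each statement's English description precedes it below -/
import Mathlib

section
/- Let Q ≥ 1 be an integer, let k be an integer with 0 ≤ k ≤ Q−1, and let β ∈ (0,1). Then the equation (β/(Q+1))·Σ_{q=k}^{Q} C(q,k)·ι^{q−k} − C(Q,k)·ι^{Q−k} = 0 (in the real variable ι, where C(q,k) denotes the binomial coefficient) has exactly one solution ι(k) in the open interval (0,1). -/
/-- The quotient `(∑_{q=k}^{Q} C(q,k) · x^{q-k}) / x^{Q-k}` is strictly decreasing on the positive
reals, stated without division. -/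
theorem sum_choose_mul_pow_mul_pow_lt {Q k : ℕ} (hkQ : k < Q) {x y : ℝ} (hx : 0 < x)
    (hxy : x < y) :
    (∑ q ∈ Finset.Icc k Q, (q.choose k : ℝ) * y ^ (q - k)) * x ^ (Q - k) <
      (∑ q ∈ Finset.Icc k Q, (q.choose k : ℝ) * x ^ (q - k)) * y ^ (Q - k) := by
  rw [Finset.sum_mul, Finset.sum_mul]
  refine Finset.sum_lt_sum (fun q hq => ?_) ⟨k, Finset.mem_Icc.2 ⟨le_rfl, hkQ.le⟩, ?_⟩
  · obtain ⟨h₁, h₂⟩ := Finset.mem_Icc.1 hq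
    have hy : 0 < y := hx.trans hxy
    obtain ⟨d, hd⟩ : ∃ d, Q - k = (q - k) + d := ⟨Q - q, by omega⟩
    have hpow : x ^ d ≤ y ^ d := by gcongr
    calc (q.choose k : ℝ) * y ^ (q - k) * x ^ (Q - k)
        = (q.choose k : ℝ) * y ^ (q - k) * x ^ (q - k) * x ^ d := by rw [hd]; ring
      _ ≤ (q.choose k : ℝ) * y ^ (q - k) * x ^ (q - k) * y ^ d := by gcongr
      _ = (q.choose k : ℝ) * x ^ (q - k) * y ^ (Q - k) := by rw [hd]; ring
  · simpa using pow_lt_pow_left₀ hxy hx.le (by omega : Q - k ≠ 0)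

/-- The sum of the binomial coefficients `C(q,k)` over `k ≤ q ≤ Q` is at most
`(Q + 1) * C(Q,k)`. -/
theorem sum_Icc_choose_le_succ_mul_choose (Q k : ℕ) :
    ∑ q ∈ Finset.Icc k Q, q.choose k ≤ (Q + 1) * Q.choose k := by
  rw [Nat.sum_Icc_choose, Nat.add_one_mul_choose_eq]
  exact Nat.le_mul_of_pos_right _ k.succ_pos

/-- For integers `Q ≥ 1`, `0 ≤ k ≤ Q - 1`, and `β ∈ (0,1)`, the polynomial
equation `(β/(Q+1)) · ∑_{q=k}^{Q} C(q,k) · ι^{q-k} − C(Q,k) · ι^{Q-k} = 0` has exactly one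
solution `ι` in the open interval `(0,1)`. -/
theorem scenario_polynomial_unique_root (Q k : ℕ) (hQ : 1 ≤ Q) (hk : k ≤ Q - 1)
    (β : ℝ) (hβ : β ∈ Set.Ioo (0 : ℝ) 1) :
    ∃! ι : ℝ, ι ∈ Set.Ioo (0 : ℝ) 1 ∧
      (β / (Q + 1)) * (∑ q ∈ Finset.Icc k Q, (q.choose k : ℝ) * ι ^ (q - k))
        - (Q.choose k : ℝ) * ι ^ (Q - k) = 0 := by
  obtain ⟨hβ₀, hβ₁⟩ := hβ
  have hkQ : k < Q := by omega
  have hC : (0 : ℝ) < Q.choose k := by exact_mod_cast Nat.choose_pos hkQ.le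
  have hc : 0 < β / ((Q : ℝ) + 1) := by positivity
  set f : ℝ → ℝ := fun t =>
    (β / (Q + 1)) * (∑ q ∈ Finset.Icc k Q, (q.choose k : ℝ) * t ^ (q - k))
      - (Q.choose k : ℝ) * t ^ (Q - k) with hf
  have hcont : ContinuousOn f (Set.Icc 0 1) := by
    apply Continuous.continuousOn
    fun_prop
  have hf₀ : 0 < f 0 := by
    have hle : (1 : ℝ) ≤ ∑ q ∈ Finset.Icc k Q, (q.choose k : ℝ) * (0 : ℝ) ^ (q - k) := by
      simpa using Finset.single_le_sum
        (f := fun q : ℕ => (q.choose k : ℝ) * (0 : ℝ) ^ (q - k))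
        (fun q _ => by positivity) (Finset.mem_Icc.2 ⟨le_rfl, hkQ.le⟩)
    have hzero : (0 : ℝ) ^ (Q - k) = 0 := zero_pow (by omega)
    simp only [hf, hzero, mul_zero, sub_zero]
    exact mul_pos hc (by linarith)
  have hf₁ : f 1 < 0 := by
    have hle : ∑ q ∈ Finset.Icc k Q, (q.choose k : ℝ) ≤ ((Q : ℝ) + 1) * Q.choose k := by
      exact_mod_cast sum_Icc_choose_le_succ_mul_choose Q k
    simp only [hf, one_pow, mul_one, sub_neg]
    calc β / ((Q : ℝ) + 1) * ∑ q ∈ Finset.Icc k Q, (q.choose k : ℝ)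
        ≤ β / ((Q : ℝ) + 1) * (((Q : ℝ) + 1) * Q.choose k) := by gcongr
      _ = β * Q.choose k := by field_simp
      _ < Q.choose k := mul_lt_of_lt_one_left hC hβ₁
  have hne : ∀ x y : ℝ, 0 < x → x < y → f x = 0 → f y ≠ 0 := by
    intro x y hx hxy hfx hfy
    have hlt := mul_lt_mul_of_pos_left (sum_choose_mul_pow_mul_pow_lt hkQ hx hxy) hc
    rw [← mul_assoc, ← mul_assoc, sub_eq_zero.1 hfx, sub_eq_zero.1 hfy, mul_right_comm] at hlt
    exact lt_irrefl _ hlt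
  obtain ⟨t, ht, hft⟩ := intermediate_value_Ioo' zero_le_one hcont ⟨hf₁, hf₀⟩
  refine ⟨t, ⟨ht, hft⟩, ?_⟩
  rintro s ⟨hs, hfs⟩
  rcases lt_trichotomy s t with h | h | h
  · exact absurd hft (hne s t hs.1 h hfs)
  · exact h
  · exact absurd hfs (hne t s ht.1 h hft)
end

section
/- Fix n ∈ ℕ and define discrete-time bounded STL formulas over state space ℝⁿ by the inductive grammar: φ ::= π_α | ¬φ | φ₁ ∧ φ₂ | φ₁ U_{[a,b]} φ₂, where α : ℝⁿ → ℝ and a ≤ b are natural numbers. For a run ξ : ℕ → ℝⁿ and time k ∈ ℕ, define Boolean satisfaction recursively by: (ξ,k) ⊨ π_α iff α(ξ(k)) ≥ 0; (ξ,k) ⊨ ¬φ iff not (ξ,k) ⊨ φ; (ξ,k) ⊨ φ₁ ∧ φ₂ iff both hold at (ξ,k); and (ξ,k) ⊨ φ₁ U_{[a,b]} φ₂ iff there exists i ∈ {a,…,b} with (ξ,k+i) ⊨ φ₂ and (ξ,k+j) ⊨ φ₁ for all 0 ≤ j < i. Define the robustness ρ^φ(ξ,k) ∈ ℝ recursively by: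 ρ^{π_α}(ξ,k) = α(ξ(k)); ρ^{¬φ}(ξ,k) = −ρ^φ(ξ,k); ρ^{φ₁∧φ₂}(ξ,k) = min(ρ^{φ₁}(ξ,k), ρ^{φ₂}(ξ,k)); ρ^{φ₁ U_{[a,b]} φ₂}(ξ,k) = max_{i∈[a,b]} min( ρ^{φ₂}(ξ,k+i), min_{j∈[0,i)} ρ^{φ₁}(ξ,k+j) ) (the inner minimum over an empty range being omitted). Then for every formula φ, run ξ, and time k: if ρ^φ(ξ,k) > 0 then (ξ,k) ⊨ φ, and if ρ^φ(ξ,k) < 0 then (ξ,k) ⊭ φ. -/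
/-- Discrete-time bounded STL formulas over state space `ℝⁿ`:
predicates `π_α` (for `α : ℝⁿ → ℝ`), negation, conjunction, and bounded until
`φ₁ U_{[a,b]} φ₂` with `a ≤ b`. -/
inductive STL (n : ℕ) : Type
  | pred (α : (Fin n → ℝ) → ℝ) : STL n
  | not (φ : STL n) : STL n
  | and (φ₁ φ₂ : STL n) : STL n
  | untl (a b : ℕ) (hab : a ≤ b) (φ₁ φ₂ : STL n) : STL n

/-- Boolean satisfaction of an STL formula by a run `ξ : ℕ → ℝⁿ` at time `k`. -/
def STL.Sat {n : ℕ} : STL n → (ℕ → (Fin n → ℝ)) → ℕ → Prop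
  | .pred α, ξ, k => 0 ≤ α (ξ k)
  | .not φ, ξ, k => ¬ φ.Sat ξ k
  | .and φ₁ φ₂, ξ, k => φ₁.Sat ξ k ∧ φ₂.Sat ξ k
  | .untl a b _ φ₁ φ₂, ξ, k =>
      ∃ i : ℕ, a ≤ i ∧ i ≤ b ∧ φ₂.Sat ξ (k + i) ∧ ∀ j < i, φ₁.Sat ξ (k + j)

/-- Quantitative robustness of an STL formula along a run `ξ : ℕ → ℝⁿ` at time `k`.
For the until operator it is `max_{i ∈ [a,b]} min(ρ^{φ₂}(ξ,k+i), min_{j ∈ [0,i)} ρ^{φ₁}(ξ,k+j))`,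
the inner minimum over an empty range being omitted. -/
noncomputable def STL.rob {n : ℕ} : STL n → (ℕ → (Fin n → ℝ)) → ℕ → ℝ
  | .pred α, ξ, k => α (ξ k)
  | .not φ, ξ, k => - φ.rob ξ k
  | .and φ₁ φ₂, ξ, k => min (φ₁.rob ξ k) (φ₂.rob ξ k)
  | .untl a b hab φ₁ φ₂, ξ, k =>
      (Finset.Icc a b).sup' (Finset.nonempty_Icc.mpr hab) (fun i =>
        (insert (φ₂.rob ξ (k + i)) ((Finset.range i).image fun j => φ₁.rob ξ (k + j))).inf'
          (Finset.insert_nonempty _ _) id)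

/-- **soundness of STL robustness.** For every formula `φ`, run `ξ`, and time
`k`: strictly positive robustness implies Boolean satisfaction, and strictly negative
robustness implies violation. -/
theorem STL.rob_sound {n : ℕ} (φ : STL n) (ξ : ℕ → (Fin n → ℝ)) (k : ℕ) :
    (0 < φ.rob ξ k → φ.Sat ξ k) ∧ (φ.rob ξ k < 0 → ¬ φ.Sat ξ k) := by
  induction φ generalizing k with
  | pred α => exact ⟨fun h => h.le, fun h => not_le.mpr h⟩
  | not φ ih =>
    simp only [STL.rob, STL.Sat, Left.neg_pos_iff, Left.neg_neg_iff, not_not]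
    exact ⟨(ih k).2, (ih k).1⟩
  | and φ₁ φ₂ ih₁ ih₂ =>
    simp only [STL.rob, STL.Sat, lt_min_iff, min_lt_iff]
    exact ⟨fun h => ⟨(ih₁ k).1 h.1, (ih₂ k).1 h.2⟩,
      fun h hs => h.elim (fun h => (ih₁ k).2 h hs.1) fun h => (ih₂ k).2 h hs.2⟩
  | untl a b hab φ₁ φ₂ ih₁ ih₂ =>
    simp only [STL.rob, STL.Sat, Finset.lt_sup'_iff, Finset.sup'_lt_iff, Finset.lt_inf'_iff,
      Finset.inf'_lt_iff, Finset.mem_Icc, Finset.forall_mem_insert, Finset.exists_mem_insert,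
      Finset.forall_mem_image, Finset.exists_mem_image, Finset.mem_range, id]
    constructor
    · rintro ⟨i, ⟨hai, hib⟩, h₂, h₁⟩
      exact ⟨i, hai, hib, (ih₂ _).1 h₂, fun j hj => (ih₁ _).1 (h₁ hj)⟩
    · rintro h ⟨i, hai, hib, h₂, h₁⟩
      obtain h | ⟨j, hj, h⟩ := h i ⟨hai, hib⟩
      · exact (ih₂ _).2 h h₂
      · exact (ih₁ _).2 h (h₁ j hj)
end
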